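/- Proposition 5(3): In the left-censored disclosure model, in every truth-leaning equilibrium (σ, a, μ): for all e, m ∈ E with σ(m|e) > 0, L(m) ≥ max{k : 0 ≤ k ≤ L(e) and D(e|_k) = N(e)}; that is, every message disclosed with positive probability at evidence e contains as a suffix the longest truncation of e attaining the maximal difference N(e). -/

import Mathlib

open scoped BigOperators

namespace LeftCensored

/-- Evidence: a finite sequence of binary signals; `true` stands for a high
return (`g`) and `false` for a low return (`b`). A sequence is a list whose
suffixes are the most recent signals. -/
abbrev Ev := List Bool

/-- `G(e)`: the number of `g`'s in `e`. -/
def Gc (e : Ev) : ℕ := e.count true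

/-- `B(e)`: the number of `b`'s in `e`. -/
def Bc (e : Ev) : ℕ := e.count false

/-- `D(e) = G(e) − B(e)`. -/
def D (e : Ev) : ℤ := (Gc e : ℤ) - (Bc e : ℤ)

/-- `N(e) = max_{0 ≤ k ≤ L(e)} D(e|_k)`, the maximum of `D` over all suffixes
(truncations from the left) of `e`; since the empty suffix gives `D = 0`, this
equals the fold of `max` over the suffixes starting from `0`. -/
def N (e : Ev) : ℤ := (e.tails.map D).foldr max 0

/-- The evidence distribution in the good state. -/
noncomputable def FG (p q : ℝ) (e : Ev) : ℝ := (1 - p - q) * p ^ Gc e * q ^ Bc e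

/-- The evidence distribution in the bad state. -/
noncomputable def FB (p q : ℝ) (e : Ev) : ℝ := (1 - p - q) * p ^ Bc e * q ^ Gc e

/-- Posterior belief `ν(A)` that the state is good given evidence in `A`. -/
noncomputable def nu (p q π0 : ℝ) (A : Set Ev) : ℝ :=
  ((∑' e : A, FG p q e) * π0) /
    ((∑' e : A, FG p q e) * π0 + (∑' e : A, FB p q e) * (1 - π0))

/-- `α = (1 − √(1 − 4pq))/2`. -/
noncomputable def alpha (p q : ℝ) : ℝ := (1 - Real.sqrt (1 - 4 * p * q)) / 2

/-- The sender's equilibrium value function (Proposition 4). -/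
noncomputable def V (p q π0 : ℝ) (e : Ev) : ℝ :=
  1 / (1 + ((1 - π0) / π0) * ((p - alpha p q) / (q - alpha p q)) * (q / p) ^ (N e + 1))

/-- `L` is a (nonempty) lower contour set in `A` with respect to the suffix
(left-censoring) order. -/
def IsLCS (A L : Set Ev) : Prop :=
  L.Nonempty ∧ L ⊆ A ∧ ∀ e ∈ L, ∀ e' ∈ A, e' <:+ e → e' ∈ L

/-- A truth-leaning equilibrium of the left-censored disclosure game (the
receiver's response `φ` is the identity). -/
structure Eqm (p q π0 : ℝ) where
  σ : Ev → Ev → ℝ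
  act : Ev → ℝ
  μ : Ev → ℝ
  σ_nonneg : ∀ e m, 0 ≤ σ e m
  σ_hasSum : ∀ e, HasSum (σ e) 1
  feasible : ∀ e m, 0 < σ e m → m <:+ e
  μ_mem : ∀ m, μ m ∈ Set.Icc (0 : ℝ) 1
  sender_opt : ∀ e m, 0 < σ e m → ∀ m', m' <:+ e → act m' ≤ act m
  receiver_opt : ∀ m, act m = μ m
  bayes : ∀ m, (∃ e, 0 < σ e m) →
    μ m = (∑' e : {e : Ev // m <:+ e}, σ e.1 m * FG p q e.1 * π0) /
      (∑' e : {e : Ev // m <:+ e}, σ e.1 m * (FG p q e.1 * π0 + FB p q e.1 * (1 - π0)))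
  truth_leaning : ∀ e, (∀ m, m <:+ e → act m ≤ act e) → σ e e = 1
  offpath : ∀ m, (¬ ∃ e, 0 < σ e m) → μ m = nu p q π0 {m}

end LeftCensored

namespace LeftCensored

lemma Gc_append (s x : Ev) : Gc (s ++ x) = Gc s + Gc x := List.count_append

lemma Bc_append (s x : Ev) : Bc (s ++ x) = Bc s + Bc x := List.count_append

lemma FG_append (p q : ℝ) (s x : Ev) :
    FG p q (s ++ x) = FG p q s * (p ^ Gc x * q ^ Bc x) := by
  simp only [FG, Gc_append, Bc_append, pow_add]; ring

lemma FB_append (p q : ℝ) (s x : Ev) :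
    FB p q (s ++ x) = FB p q s * (p ^ Bc x * q ^ Gc x) := by
  simp only [FB, Gc_append, Bc_append, pow_add]; ring

lemma FG_pos {p q : ℝ} (hp : 0 < p) (hq : 0 < q) (hpq : p + q < 1) (e : Ev) :
    0 < FG p q e :=
  mul_pos (mul_pos (by linarith) (pow_pos hp _)) (pow_pos hq _)

lemma FB_pos {p q : ℝ} (hp : 0 < p) (hq : 0 < q) (hpq : p + q < 1) (e : Ev) :
    0 < FB p q e :=
  mul_pos (mul_pos (by linarith) (pow_pos hp _)) (pow_pos hq _)

lemma D_le_N {x e : Ev} (h : x <:+ e) : D x ≤ N e := by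
  induction e with
  | nil => simp [List.suffix_nil.mp h, D, N, Gc, Bc]
  | cons a t ih =>
    have hN : N (a :: t) = max (D (a :: t)) (N t) := by simp [N]
    rw [hN]
    rcases List.suffix_cons_iff.mp h with rfl | h
    · exact le_max_left _ _
    · exact (ih h).trans (le_max_right _ _)

lemma sum_weight_le {p q : ℝ} (hp : 0 < p) (hq : 0 < q) (hpq : p + q < 1) (n : ℕ) :
    ∀ u : Finset Ev, (∀ e ∈ u, e.length ≤ n) →
      ∑ e ∈ u, p ^ Gc e * q ^ Bc e ≤ 1 / (1 - p - q) := by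
  have hpos : 0 < 1 - p - q := by linarith
  have hone : (1 : ℝ) ≤ 1 / (1 - p - q) := by
    rw [le_div_iff₀ hpos]; linarith
  have hw (e : Ev) : 0 ≤ p ^ Gc e * q ^ Bc e := by positivity
  induction n with
  | zero =>
    intro u hu
    have hsub : u ⊆ {[]} := fun e he => by
      simpa using List.length_eq_zero_iff.mp (Nat.le_zero.mp (hu e he))
    calc _ ≤ ∑ e ∈ ({[]} : Finset Ev), p ^ Gc e * q ^ Bc e :=
          Finset.sum_le_sum_of_subset_of_nonneg hsub fun e _ _ => hw e
      _ ≤ _ := by simpa [Gc, Bc] using hone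
  | succ n ih =>
    intro u hu
    set t := u.image List.tail
    have hT : ∑ e ∈ t, p ^ Gc e * q ^ Bc e ≤ 1 / (1 - p - q) := ih t fun e he => by
      obtain ⟨e', he', rfl⟩ := Finset.mem_image.mp he
      have := hu e' he'
      simp only [List.length_tail]; omega
    have hsub : u ⊆ {[]} ∪ (t.image (List.cons true) ∪ t.image (List.cons false)) := by
      intro e he
      rcases e with _ | ⟨a, s⟩
      · simp
      · have hs : s ∈ t := Finset.mem_image.mpr ⟨_, he, rfl⟩
        cases a <;> simp [hs]
    have himage (a : Bool) : ∑ e ∈ t.image (List.cons a), p ^ Gc e * q ^ Bc e =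
        ∑ e ∈ t, p ^ Gc (a :: e) * q ^ Bc (a :: e) :=
      Finset.sum_image (fun _ _ _ _ h => List.cons_injective h)
    have htrue : ∑ e ∈ t.image (List.cons true), p ^ Gc e * q ^ Bc e =
        p * ∑ e ∈ t, p ^ Gc e * q ^ Bc e := by
      rw [himage, Finset.mul_sum]
      exact Finset.sum_congr rfl fun e _ => by simp [Gc, Bc, pow_succ]; ring
    have hfalse : ∑ e ∈ t.image (List.cons false), p ^ Gc e * q ^ Bc e =
        q * ∑ e ∈ t, p ^ Gc e * q ^ Bc e := by
      rw [himage, Finset.mul_sum]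
      exact Finset.sum_congr rfl fun e _ => by simp [Gc, Bc, pow_succ]; ring
    have hunion (a b : Finset Ev) : ∑ e ∈ a ∪ b, p ^ Gc e * q ^ Bc e ≤
        ∑ e ∈ a, p ^ Gc e * q ^ Bc e + ∑ e ∈ b, p ^ Gc e * q ^ Bc e := by
      rw [← Finset.sum_union_inter]
      exact le_add_of_nonneg_right (Finset.sum_nonneg fun e _ => hw e)
    have hnil : ∑ e ∈ ({[]} : Finset Ev), p ^ Gc e * q ^ Bc e = 1 := by simp [Gc, Bc]
    calc _ ≤ _ := Finset.sum_le_sum_of_subset_of_nonneg hsub fun e _ _ => hw e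
      _ ≤ 1 + (p * ∑ e ∈ t, p ^ Gc e * q ^ Bc e + q * ∑ e ∈ t, p ^ Gc e * q ^ Bc e) := by
        refine (hunion _ _).trans ?_
        rw [hnil, ← htrue, ← hfalse]
        exact add_le_add le_rfl (hunion _ _)
      _ = 1 + (p + q) * ∑ e ∈ t, p ^ Gc e * q ^ Bc e := by ring
      _ ≤ 1 + (p + q) * (1 / (1 - p - q)) := by gcongr
      _ = 1 / (1 - p - q) := by field_simp; ring

lemma summable_weight {p q : ℝ} (hp : 0 < p) (hq : 0 < q) (hpq : p + q < 1) :
    Summable fun e : Ev => p ^ Gc e * q ^ Bc e :=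
  summable_of_sum_le (fun e => by positivity) fun u =>
    sum_weight_le hp hq hpq (u.sup List.length) u fun _ he => Finset.le_sup (f := List.length) he

lemma summable_FG {p q : ℝ} (hp : 0 < p) (hq : 0 < q) (hpq : p + q < 1) :
    Summable (FG p q) :=
  ((summable_weight hp hq hpq).mul_left (1 - p - q)).congr fun e => by simp only [FG]; ring

lemma summable_FB {p q : ℝ} (hp : 0 < p) (hq : 0 < q) (hpq : p + q < 1) :
    Summable (FB p q) :=
  ((summable_weight hq hp (by linarith)).mul_left (1 - p - q)).congr fun e => by
    simp only [FB]; ring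

/-- The mass of `e` in the good state in excess of what the posterior `v` requires; it is
nonnegative exactly when the posterior at `e` is at least `v`. -/
noncomputable def excess (p q π0 v : ℝ) (e : Ev) : ℝ :=
  FG p q e * π0 - v * (FG p q e * π0 + FB p q e * (1 - π0))

lemma summable_excess {p q : ℝ} (hp : 0 < p) (hq : 0 < q) (hpq : p + q < 1) (π0 v : ℝ) :
    Summable (excess p q π0 v) :=
  ((summable_FG hp hq hpq).mul_right π0).sub
    ((((summable_FG hp hq hpq).mul_right π0).add
      ((summable_FB hp hq hpq).mul_right (1 - π0))).mul_left v)

lemma nu_singleton (p q π0 : ℝ) (e : Ev) :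
    nu p q π0 {e} = FG p q e * π0 / (FG p q e * π0 + FB p q e * (1 - π0)) := by
  simp [nu]

/-- The total excess of a tree grafted at `x`, as a function of the root `x`. -/
lemma tsum_indicator_graft {p q : ℝ} (hp : 0 < p) (hq : 0 < q) (hpq : p + q < 1) (π0 v : ℝ)
    (S : Set Ev) (x : Ev) :
    ∑' e, ((· ++ x) '' S).indicator (excess p q π0 v) e =
      ((1 - v) * π0 * ∑' s, S.indicator (FG p q) s) * (p ^ Gc x * q ^ Bc x) -
        (v * (1 - π0) * ∑' s, S.indicator (FB p q) s) * (p ^ Bc x * q ^ Gc x) := by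
  have hinj : Function.Injective (fun s : Ev => s ++ x) := List.append_left_injective x
  have hrange : Function.support (((· ++ x) '' S).indicator (excess p q π0 v)) ⊆
      Set.range (fun s : Ev => s ++ x) :=
    Set.support_indicator_subset.trans (Set.image_subset_range _ _)
  have hG := (summable_FG hp hq hpq).indicator S
  have hB := (summable_FB hp hq hpq).indicator S
  rw [← hinj.tsum_eq hrange, ← tsum_mul_left, ← tsum_mul_left, ← tsum_mul_right,
    ← tsum_mul_right, ← ((hG.mul_left _).mul_right _).tsum_sub ((hB.mul_left _).mul_right _)]
  refine tsum_congr fun s => ?_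
  by_cases hs : s ∈ S
  · rw [Set.indicator_of_mem (Set.mem_image_of_mem _ hs), Set.indicator_of_mem hs,
      Set.indicator_of_mem hs, excess, FG_append, FB_append]
    ring
  · rw [Set.indicator_of_notMem (fun h => hs (hinj.mem_set_image.mp h)),
      Set.indicator_of_notMem hs, Set.indicator_of_notMem hs]
    ring

/-- Regrafting a tree at a root with a larger difference `D` preserves nonnegativity of its
total excess. -/
lemma tsum_graft_nonneg_mono {p q π0 v : ℝ} (hq : 0 < q) (hqp : q < p) (hpq : p + q < 1)
    (h0 : 0 < π0) (hv1 : v ≤ 1) (S : Set Ev) {x y : Ev} (hD : D x ≤ D y)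
    (hx : 0 ≤ ∑' e, ((· ++ x) '' S).indicator (excess p q π0 v) e) :
    0 ≤ ∑' e, ((· ++ y) '' S).indicator (excess p q π0 v) e := by
  have hp : 0 < p := hq.trans hqp
  rw [tsum_indicator_graft hp hq hpq, sub_nonneg] at hx ⊢
  set A := (1 - v) * π0 * ∑' s, S.indicator (FG p q) s
  set B := v * (1 - π0) * ∑' s, S.indicator (FB p q) s
  have hA : 0 ≤ A := mul_nonneg (mul_nonneg (by linarith) h0.le)
    (tsum_nonneg fun s => Set.indicator_nonneg (fun s _ => (FG_pos hp hq hpq s).le) s)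
  have hcross : (p ^ Gc x * q ^ Bc x) * (p ^ Bc y * q ^ Gc y) ≤
      (p ^ Gc y * q ^ Bc y) * (p ^ Bc x * q ^ Gc x) := by
    obtain ⟨d, hd⟩ : ∃ d, Gc y + Bc x = Gc x + Bc y + d :=
      Nat.exists_eq_add_of_le (by simp only [D] at hD; omega)
    calc _ = p ^ (Gc x + Bc y) * q ^ (Gc y + Bc x) := by ring
      _ = p ^ (Gc x + Bc y) * q ^ (Gc x + Bc y) * q ^ d := by rw [hd]; ring
      _ ≤ p ^ (Gc x + Bc y) * q ^ (Gc x + Bc y) * p ^ d := by gcongr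
      _ = p ^ (Gc y + Bc x) * q ^ (Gc x + Bc y) := by rw [hd]; ring
      _ = _ := by ring
  have hr : 0 < p ^ Bc x * q ^ Gc x := by positivity
  refine le_of_mul_le_mul_right ?_ hr
  calc _ = B * (p ^ Bc x * q ^ Gc x) * (p ^ Bc y * q ^ Gc y) := by ring
    _ ≤ A * (p ^ Gc x * q ^ Bc x) * (p ^ Bc y * q ^ Gc y) := by gcongr
    _ = A * ((p ^ Gc x * q ^ Bc x) * (p ^ Bc y * q ^ Gc y)) := by ring
    _ ≤ A * ((p ^ Gc y * q ^ Bc y) * (p ^ Bc x * q ^ Gc x)) := by gcongr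
    _ = _ := by ring

namespace Eqm

variable {p q π0 : ℝ} (Q : Eqm p q π0)

lemma exists_message (e : Ev) : ∃ m, 0 < Q.σ e m := by
  by_contra! h
  have hz : Q.σ e = 0 := funext fun m => le_antisymm (h m) (Q.σ_nonneg e m)
  have := Q.σ_hasSum e
  rw [hz] at this
  exact zero_ne_one (hasSum_zero.unique this)

/-- The sender's equilibrium payoff at `e`. -/
noncomputable def value (e : Ev) : ℝ := Q.act (Q.exists_message e).choose

lemma act_le_value {e m : Ev} (h : m <:+ e) : Q.act m ≤ Q.value e :=
  Q.sender_opt e _ (Q.exists_message e).choose_spec m h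

lemma act_eq_value {e m : Ev} (h : 0 < Q.σ e m) : Q.act m = Q.value e :=
  le_antisymm (Q.act_le_value (Q.feasible e m h))
    (Q.sender_opt e m h _ (Q.feasible e _ (Q.exists_message e).choose_spec))

lemma value_mono {e e' : Ev} (h : e <:+ e') : Q.value e ≤ Q.value e' :=
  Q.act_le_value ((Q.feasible e _ (Q.exists_message e).choose_spec).trans h)

lemma value_eq_of_sends {e m : Ev} (h : 0 < Q.σ e m) : Q.value m = Q.value e :=
  le_antisymm (Q.value_mono (Q.feasible e m h))
    ((Q.act_eq_value h).symm.le.trans (Q.act_le_value List.suffix_rfl))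

lemma value_le_one (e : Ev) : Q.value e ≤ 1 := by
  rw [value, Q.receiver_opt]
  exact (Q.μ_mem _).2

lemma truthful_of_onpath {e m : Ev} (h : 0 < Q.σ e m) : Q.σ m m = 1 :=
  Q.truth_leaning m fun m' hm' => Q.sender_opt e m h m' (hm'.trans (Q.feasible e m h))

lemma eq_zero_of_truthful {e m : Ev} (h : Q.σ e e = 1) (hne : m ≠ e) : Q.σ e m = 0 := by
  have hle := sum_le_hasSum {e, m} (fun i _ => Q.σ_nonneg e i) (Q.σ_hasSum e)
  rw [Finset.sum_pair hne.symm, h] at hle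
  exact le_antisymm (by linarith) (Q.σ_nonneg e m)

lemma σ_le_one (e m : Ev) : Q.σ e m ≤ 1 :=
  le_hasSum (Q.σ_hasSum e) m fun i _ => Q.σ_nonneg e i

lemma summable_flow {g : Ev → ℝ} (hg : Summable g) :
    Summable fun x : Ev × Ev => Q.σ x.1 x.2 * g x.1 := by
  refine Summable.of_norm ((summable_prod_of_nonneg fun _ => norm_nonneg _).mpr ?_)
  have hrow (e : Ev) : HasSum (fun m => ‖Q.σ e m * g e‖) ‖g e‖ := by
    simpa [abs_of_nonneg (Q.σ_nonneg e _)] using (Q.σ_hasSum e).mul_right |g e|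
  exact ⟨fun e => (hrow e).summable, hg.norm.congr fun e => (hrow e).tsum_eq.symm⟩

lemma summable_received {g : Ev → ℝ} (hg : Summable g) :
    Summable fun m => ∑' e, Q.σ e m * g e :=
  (Q.summable_flow hg).prod_symm.prod

lemma summable_senders {g : Ev → ℝ} (hg : Summable g) (m : Ev) :
    Summable fun e => Q.σ e m * g e :=
  hg.norm.of_norm_bounded fun e => by
    rw [norm_mul, Real.norm_of_nonneg (Q.σ_nonneg e m)]
    exact mul_le_of_le_one_left (norm_nonneg _) (Q.σ_le_one e m)

lemma tsum_eq_tsum_received {g : Ev → ℝ} (hg : Summable g) :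
    ∑' e, g e = ∑' m, ∑' e, Q.σ e m * g e := by
  have hswap := (Q.summable_flow hg).prod_symm.tsum_comm (f := fun m e => Q.σ e m * g e)
  rw [← hswap]
  refine tsum_congr fun e => ?_
  rw [tsum_mul_right, (Q.σ_hasSum e).tsum_eq, one_mul]

/-- Evidence that conceals something has a posterior below the payoff it obtains. -/
lemma excess_neg (hp : 0 < p) (hq : 0 < q) (hpq : p + q < 1) (h0 : 0 < π0) (h1 : π0 < 1)
    {e m : Ev} (h : 0 < Q.σ e m) (hne : m ≠ e) : excess p q π0 (Q.act m) e < 0 := by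
  have hnot : Q.σ e e ≠ 1 := fun h' => h.ne' (Q.eq_zero_of_truthful h' hne)
  have hoff : ¬ ∃ e', 0 < Q.σ e' e := fun ⟨_, he'⟩ => hnot (Q.truthful_of_onpath he')
  obtain ⟨m', hm', hlt⟩ : ∃ m', m' <:+ e ∧ Q.act e < Q.act m' := by
    by_contra! hcon
    exact hnot (Q.truth_leaning e hcon)
  have hact : Q.act e < Q.act m := hlt.trans_le (Q.sender_opt e m h m' hm')
  rw [Q.receiver_opt e, Q.offpath e hoff, nu_singleton, div_lt_iff₀] at hact
  · exact sub_neg.mpr hact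
  · exact add_pos (mul_pos (FG_pos hp hq hpq e) h0)
      (mul_pos (FB_pos hp hq hpq e) (by linarith))

/-- Bayesian consistency: the senders of an on-path message have zero total excess. -/
lemma tsum_senders_eq_zero (hp : 0 < p) (hq : 0 < q) (hpq : p + q < 1) (h0 : 0 < π0)
    (h1 : π0 < 1) {e₀ m : Ev} (h : 0 < Q.σ e₀ m) :
    ∑' e, Q.σ e m * excess p q π0 (Q.act m) e = 0 := by
  have hz {e : Ev} (he : ¬ m <:+ e) : Q.σ e m = 0 :=
    le_antisymm (not_lt.mp fun hlt => he (Q.feasible e m hlt)) (Q.σ_nonneg e m)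
  have hsub (g : Ev → ℝ) :
      ∑' e : {e : Ev // m <:+ e}, Q.σ e.1 m * g e.1 = ∑' e, Q.σ e m * g e := by
    refine tsum_subtype_eq_of_support_subset (s := {e : Ev | m <:+ e})
      (f := fun e => Q.σ e m * g e) fun e he => ?_
    by_contra hcon
    exact he (by simp [hz hcon])
  have hG := (summable_FG hp hq hpq).mul_right π0
  have hT := hG.add ((summable_FB hp hq hpq).mul_right (1 - π0))
  have hTpos (e : Ev) : 0 < FG p q e * π0 + FB p q e * (1 - π0) :=
    add_pos (mul_pos (FG_pos hp hq hpq e) h0) (mul_pos (FB_pos hp hq hpq e) (by linarith))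
  have hb := Q.bayes m ⟨e₀, h⟩
  simp only [mul_assoc] at hb
  rw [hsub fun e => FG p q e * π0,
    hsub fun e => FG p q e * π0 + FB p q e * (1 - π0), eq_div_iff] at hb
  · have hsplit (e : Ev) : Q.σ e m * excess p q π0 (Q.act m) e = Q.σ e m * (FG p q e * π0) -
        Q.μ m * (Q.σ e m * (FG p q e * π0 + FB p q e * (1 - π0))) := by
      rw [excess, Q.receiver_opt]; ring
    rw [tsum_congr hsplit, (Q.summable_senders hG m).tsum_sub
      ((Q.summable_senders hT m).mul_left _), tsum_mul_left, hb, sub_self]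
  · refine ((Q.summable_senders hT m).tsum_pos
      (fun e => mul_nonneg (Q.σ_nonneg e m) (hTpos e).le) e₀ (mul_pos h (hTpos e₀))).ne'

/-- A tree rooted at `x`, where every proper truncation of `x` yields less than `x`, has
nonnegative total excess relative to the payoff at `x`. -/
lemma tsum_tree_nonneg (hp : 0 < p) (hq : 0 < q) (hpq : p + q < 1) (h0 : 0 < π0)
    (h1 : π0 < 1) {x : Ev} (hx : ∀ y, y <:+ x → y ≠ x → Q.value y < Q.value x)
    {T : Set Ev} (hroot : ∀ e ∈ T, x <:+ e)
    (hclosed : ∀ e ∈ T, ∀ y, x <:+ y → y <:+ e → y ∈ T) :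
    0 ≤ ∑' e, T.indicator (excess p q π0 (Q.value x)) e := by
  have hsum (v : ℝ) := (summable_excess hp hq hpq π0 v).indicator T
  rw [Q.tsum_eq_tsum_received (hsum _)]
  refine tsum_nonneg fun m => ?_
  by_cases hm : ∃ e ∈ T, 0 < Q.σ e m
  · obtain ⟨e₁, he₁, hσ⟩ := hm
    have hval := Q.act_eq_value hσ
    have hle := Q.value_mono (hroot e₁ he₁)
    have hxm : x <:+ m := by
      rcases List.suffix_or_suffix_of_suffix (hroot e₁ he₁) (Q.feasible e₁ m hσ) with h | h
      · exact h
      · by_contra hcon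
        have hlt := hx m h fun h' => hcon (h' ▸ List.suffix_rfl)
        have := Q.act_le_value (m := m) List.suffix_rfl
        linarith
    have hmT : m ∈ T := hclosed e₁ he₁ m hxm (Q.feasible e₁ m hσ)
    rw [← Q.tsum_senders_eq_zero hp hq hpq h0 h1 hσ]
    refine (Q.summable_senders (summable_excess hp hq hpq π0 _) m).tsum_le_tsum (fun e => ?_)
      (Q.summable_senders (hsum _) m)
    by_cases heT : e ∈ T
    · rw [Set.indicator_of_mem heT]
      refine mul_le_mul_of_nonneg_left ?_ (Q.σ_nonneg e m)
      have hpos : 0 ≤ FG p q e * π0 + FB p q e * (1 - π0) :=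
        add_nonneg (mul_nonneg (FG_pos hp hq hpq e).le h0.le)
          (mul_nonneg (FB_pos hp hq hpq e).le (by linarith))
      exact sub_le_sub_left (mul_le_mul_of_nonneg_right (hval ▸ hle) hpos) _
    · rw [Set.indicator_of_notMem heT, mul_zero]
      rcases (Q.σ_nonneg e m).eq_or_lt with hzero | hσe
      · rw [← hzero, zero_mul]
      · exact mul_nonpos_of_nonneg_of_nonpos hσe.le
          (Q.excess_neg hp hq hpq h0 h1 hσe fun h => heT (h ▸ hmT)).le
  · push Not at hm
    refine tsum_nonneg fun e => ?_
    by_cases heT : e ∈ T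
    · rw [le_antisymm (hm e heT) (Q.σ_nonneg e m), zero_mul]
    · rw [Set.indicator_of_notMem heT, mul_zero]

/-- If some evidence in the tree above `y` with the payoff of `y` sends a message that is not in
this tree, then the tree has negative total excess. -/
lemma tsum_tree_neg (hp : 0 < p) (hq : 0 < q) (hpq : p + q < 1) (h0 : 0 < π0) (h1 : π0 < 1)
    {y e₀ m₀ : Ev} {v : ℝ} (hye : y <:+ e₀) (hv : Q.value e₀ = v) (hσ₀ : 0 < Q.σ e₀ m₀)
    (hm₀ : ¬ y <:+ m₀) :
    ∑' e, {e | y <:+ e ∧ Q.value e = v}.indicator (excess p q π0 v) e < 0 := by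
  set T := {e | y <:+ e ∧ Q.value e = v}
  have hsum := (summable_excess hp hq hpq π0 v).indicator T
  have hterm {m : Ev} (hm : m ∉ T) (e : Ev) :
      Q.σ e m * T.indicator (excess p q π0 v) e ≤ 0 := by
    by_cases heT : e ∈ T
    · rw [Set.indicator_of_mem heT]
      rcases (Q.σ_nonneg e m).eq_or_lt with hzero | hσ
      · rw [← hzero, zero_mul]
      · have := Q.excess_neg hp hq hpq h0 h1 hσ fun h => hm (h ▸ heT)
        rw [Q.act_eq_value hσ, heT.2] at this
        exact mul_nonpos_of_nonneg_of_nonpos hσ.le this.le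
    · rw [Set.indicator_of_notMem heT, mul_zero]
  have hm₀T : m₀ ∉ T := fun h => hm₀ h.1
  have hneg : ∑' e, Q.σ e m₀ * T.indicator (excess p q π0 v) e < 0 := by
    rw [← tsum_zero (α := ℝ) (β := Ev)]
    refine Summable.tsum_lt_tsum (i := e₀) (hterm hm₀T) ?_ (Q.summable_senders hsum m₀)
      summable_zero
    rw [Set.indicator_of_mem (show e₀ ∈ T from ⟨hye, hv⟩)]
    have := Q.excess_neg hp hq hpq h0 h1 hσ₀ fun h => hm₀ (h ▸ hye)
    rw [Q.act_eq_value hσ₀, hv] at this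
    exact mul_neg_of_pos_of_neg hσ₀ this
  rw [Q.tsum_eq_tsum_received hsum, ← tsum_zero (α := ℝ) (β := Ev)]
  refine Summable.tsum_lt_tsum (i := m₀) (fun m => ?_) hneg (Q.summable_received hsum)
    summable_zero
  by_cases hm : m ∈ T
  · refine le_of_eq ?_
    by_cases hon : ∃ e, 0 < Q.σ e m
    · obtain ⟨e₁, hσ₁⟩ := hon
      have hact : Q.act m = v := by
        rw [Q.act_eq_value hσ₁, ← Q.value_eq_of_sends hσ₁, hm.2]
      rw [← Q.tsum_senders_eq_zero hp hq hpq h0 h1 hσ₁, hact]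
      refine tsum_congr fun e => ?_
      rcases (Q.σ_nonneg e m).eq_or_lt with hzero | hσ
      · rw [← hzero, zero_mul, zero_mul]
      · have heT : e ∈ T :=
          ⟨hm.1.trans (Q.feasible e m hσ), (Q.act_eq_value hσ).symm.trans hact⟩
        rw [Set.indicator_of_mem heT]
    · push Not at hon
      have hzero (e : Ev) : Q.σ e m = 0 := le_antisymm (hon e) (Q.σ_nonneg e m)
      simp [hzero]
  · exact tsum_nonpos (hterm hm)

lemma exists_shortest_suffix (m : Ev) : ∃ x, x <:+ m ∧ Q.value x = Q.value m ∧
    ∀ y, y <:+ x → y ≠ x → Q.value y < Q.value x := by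
  induction m with
  | nil => exact ⟨[], List.suffix_rfl, rfl, fun y hy hne => absurd (List.suffix_nil.mp hy) hne⟩
  | cons a t ih =>
    rcases (Q.value_mono (List.suffix_cons a t)).eq_or_lt with heq | hlt
    · obtain ⟨x, hx, hval, hmin⟩ := ih
      exact ⟨x, hx.trans (List.suffix_cons a t), hval.trans heq, hmin⟩
    · refine ⟨a :: t, List.suffix_rfl, rfl, fun y hy hne => ?_⟩
      exact (Q.value_mono ((List.suffix_cons_iff.mp hy).resolve_left hne)).trans_lt hlt

end Eqm

/-- Proposition 5(3): in every truth-leaning equilibrium of the left-censored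
model, any message `m` disclosed with positive probability at `e` satisfies
`L(m) ≥ max{k ≤ L(e) : D(e|_k) = N(e)}` (here `e|_k = e.drop (e.length − k)`
is the suffix of `e` of length `k`). -/
theorem stmt_16 (p q π0 : ℝ) (hq0 : 0 < q) (hqp : q < p) (hp1 : p < 1)
    (hpq0 : 0 < p + q) (hpq1 : p + q < 1) (h0 : 0 < π0) (h1 : π0 < 1)
    (Q : Eqm p q π0) :
    ∀ e m : Ev, 0 < Q.σ e m →
      ∀ k : ℕ, k ≤ e.length → D (e.drop (e.length - k)) = N e → k ≤ m.length := by
  intro e m hσ k hk hD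
  by_contra! hlt
  have hp0 : 0 < p := hq0.trans hqp
  set y := e.drop (e.length - k) with hy
  have hye : y <:+ e := List.drop_suffix _ _
  have hylen : y.length = k := by rw [hy, List.length_drop]; omega
  have hme : m <:+ e := Q.feasible e m hσ
  have hmy : m <:+ y := List.suffix_of_suffix_length_le hme hye (by omega)
  have hnot : ¬ y <:+ m := fun h => by have := h.length_le; omega
  obtain ⟨x, hxm, hxval, hmin⟩ := Q.exists_shortest_suffix m
  have hxe : Q.value x = Q.value e := hxval.trans (Q.value_eq_of_sends hσ)
  have hDle : D x ≤ D y := hD ▸ D_le_N (hxm.trans hme)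
  have hneg := Q.tsum_tree_neg hp0 hq0 hpq1 h0 h1 hye hxe.symm hσ hnot
  set S : Set Ev := {s | Q.value (s ++ y) = Q.value x}
  have himage : {e' | y <:+ e' ∧ Q.value e' = Q.value x} = (· ++ y) '' S := by
    ext e'
    constructor
    · rintro ⟨⟨s, rfl⟩, hval⟩
      exact ⟨s, hval, rfl⟩
    · rintro ⟨s, hs, rfl⟩
      exact ⟨List.suffix_append s y, hs⟩
  have hyval : Q.value x ≤ Q.value y := Q.value_mono (hxm.trans hmy)
  have hnonneg := Q.tsum_tree_nonneg hp0 hq0 hpq1 h0 h1 hmin (T := (· ++ x) '' S)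
    (by rintro _ ⟨s, -, rfl⟩; exact List.suffix_append s x) (by
      rintro _ ⟨s, hs, rfl⟩ _ ⟨t, rfl⟩ hts
      obtain ⟨r, hr⟩ := hts
      have hrt : r ++ t = s := List.append_cancel_right ((List.append_assoc r t x).trans hr)
      have hle : Q.value (t ++ y) ≤ Q.value (s ++ y) :=
        Q.value_mono ⟨r, by rw [← hrt, List.append_assoc]⟩
      exact ⟨t, le_antisymm (hle.trans_eq hs)
        (hyval.trans (Q.value_mono (List.suffix_append t y))), rfl⟩)
  rw [himage] at hneg
  exact hneg.not_ge
    (tsum_graft_nonneg_mono hq0 hqp hpq1 h0 (Q.value_le_one x) S hDle hnonneg)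

end LeftCensored
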